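/- (Adelic derivation of the archimedean term / Haran's theorem at the real place) Let g : (0,∞) → ℂ be smooth and compactly supported, set g_r(t) = g(|t|) for t ∈ ℝ, and let Λ_r(s) = −Γ_r′(s)/Γ_r(s). Then for every c with 0 < c < 1 and every y ∈ ℝ, y ≠ 0: (1/2π)·∫_ℝ Λ_r(c+iτ)·ĝ(c+iτ)·|y|^{−(c+iτ)} dτ = −log|y|·g(|y|) + 𝓕( x ↦ −log|x|·(𝓕⁻¹g_r)(x) )(y), where the left-hand integral converges absolutely and the function x ↦ log|x|·(𝓕⁻¹g_r)(x) is integrable, so its Fourier transform is a continuous function. -/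

import Mathlib

open scoped Real FourierTransform

open Complex MeasureTheory Set

/-- The real Tate–Gel'fand–Graev gamma factor `Γ_r(s) = π^(1/2-s) Γ(s/2)/Γ((1-s)/2)`. -/
noncomputable def GammaR (s : ℂ) : ℂ :=
  (π : ℂ) ^ (1 / 2 - s) * Complex.Gamma (s / 2) / Complex.Gamma ((1 - s) / 2)

/-- The logarithmic derivative `Λ_r(s) = -Γ_r'(s)/Γ_r(s)`. -/
noncomputable def LambdaR (s : ℂ) : ℂ := -(deriv GammaR s / GammaR s)

/-- The standard Gaussian `x ↦ exp(-π x²)`. -/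
noncomputable def stdGaussian (x : ℝ) : ℂ := cexp (-π * x ^ 2)

lemma continuous_stdGaussian : Continuous stdGaussian := by
  unfold stdGaussian; fun_prop

lemma hasMellin_stdGaussian {s : ℂ} (hs : 0 < s.re) :
    HasMellin stdGaussian s (Gammaℝ s / 2) := by
  have hs2 : 0 < (s / 2).re := by
    have : (s / 2).re = s.re / 2 := by simp
    rw [this]; positivity
  have h1 : ∀ x : ℝ, stdGaussian x = (fun t : ℝ => cexp (-(π * t))) (x ^ (2 : ℝ)) := by
    intro x
    simp [stdGaussian]
  have h2 : mellin (fun t : ℝ => cexp (-(π * t))) (s / 2) = Gammaℝ s := by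
    have := integral_cpow_mul_exp_neg_mul_Ioi hs2 Real.pi_pos
    rw [mellin, Gammaℝ_def]
    simp only [smul_eq_mul]
    rw [this, one_div, inv_cpow, neg_div, cpow_neg]
    rw [arg_ofReal_of_nonneg Real.pi_pos.le]
    exact Real.pi_pos.ne
  have h3 : stdGaussian = fun x => (fun t : ℝ => cexp (-(π * t))) (x ^ (2 : ℝ)) := funext h1
  refine ⟨?_, ?_⟩
  · refine mellinConvergent_of_isBigO_rpow_exp Real.pi_pos (b := 0)
      (continuous_stdGaussian.locallyIntegrable.locallyIntegrableOn _) ?_ ?_ hs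
    · refine Asymptotics.IsBigO.of_bound 1 ?_
      filter_upwards [Filter.eventually_ge_atTop 1] with x hx
      rw [stdGaussian, norm_exp, one_mul, Real.norm_eq_abs, abs_of_pos (Real.exp_pos _)]
      apply Real.exp_le_exp.mpr
      have : (-(π : ℂ) * x ^ 2).re = -π * x ^ 2 := by
        norm_cast
      rw [this]
      nlinarith [Real.pi_pos, mul_le_mul_of_nonneg_left hx Real.pi_pos.le,
        mul_nonneg Real.pi_pos.le (mul_nonneg (sub_nonneg.2 hx) (zero_le_one.trans hx))]
    · simp only [neg_zero, Real.rpow_zero]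
      exact (continuous_stdGaussian.continuousAt.tendsto.isBigO_one ℝ).mono nhdsWithin_le_nhds
  · rw [h3, mellin_comp_rpow (fun t : ℝ => cexp (-(π * t))) s 2]
    simp only [ofReal_ofNat, h2]
    simp [div_eq_inv_mul]

lemma fourier_stdGaussian_comp_mul {a : ℝ} (ha : 0 < a) (t : ℝ) :
    𝓕 (fun x : ℝ => stdGaussian (x * a)) t = (a : ℂ)⁻¹ * stdGaussian (t * a⁻¹) := by
  have h := congrFun (fourier_gaussian_pi (b := (a : ℂ) ^ 2)
    (by norm_cast; positivity)) t
  have e : (fun x : ℝ => stdGaussian (x * a)) = fun x : ℝ => cexp (-π * (a : ℂ) ^ 2 * x ^ 2) := by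
    ext x; simp only [stdGaussian]; push_cast; ring_nf
  have e2 : ((a : ℂ) ^ 2) ^ (1 / 2 : ℂ) = a := by
    rw [one_div]
    have := pow_cpow_ofNat_inv (x := (a : ℂ)) (n := 2)
      (by rw [arg_ofReal_of_nonneg ha.le]; linarith [Real.pi_pos])
      (by rw [arg_ofReal_of_nonneg ha.le]; positivity)
    simpa using this
  rw [e, h, e2, stdGaussian, one_div]
  congr 2
  push_cast
  field_simp

lemma integrable_stdGaussian_comp_mul {a : ℝ} (ha : 0 < a) :
    Integrable (fun x : ℝ => stdGaussian (x * a)) := by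
  have e : (fun x : ℝ => stdGaussian (x * a)) =
      fun x : ℝ => cexp (-(π * (a : ℂ) ^ 2) * x ^ 2) := by
    ext x; simp only [stdGaussian]; push_cast; ring_nf
  rw [e]
  exact integrable_cexp_neg_mul_sq (by norm_cast; positivity)

lemma integral_Ioi_rpow_mul_norm_comp_mul (k : ℝ → ℂ) (a : ℝ) {x : ℝ} (hx : 0 < x) :
    ∫ y in Ioi 0, y ^ (a - 1) * ‖k (x * y)‖ = x ^ (-a) * ∫ y in Ioi 0, y ^ (a - 1) * ‖k y‖ := by
  have h := integral_comp_mul_left_Ioi (fun y => y ^ (a - 1) * ‖k y‖) 0 hx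
  have h2 : ∫ y in Ioi 0, (x * y) ^ (a - 1) * ‖k (x * y)‖ =
      x ^ (a - 1) * ∫ y in Ioi 0, y ^ (a - 1) * ‖k (x * y)‖ := by
    rw [← integral_const_mul]
    refine setIntegral_congr_fun measurableSet_Ioi fun y hy => ?_
    rw [Real.mul_rpow hx.le (le_of_lt hy)]; ring
  rw [h2, mul_zero, smul_eq_mul] at h
  have h3 : x ^ (a - 1) * x ^ (-a) = x⁻¹ := by
    rw [← Real.rpow_add hx, ← Real.rpow_neg_one]; ring_nf
  have h4 : x ^ (a - 1) ≠ 0 := (Real.rpow_pos_of_pos hx _).ne'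
  apply mul_left_cancel₀ h4
  rw [h, ← mul_assoc, h3]

lemma mellin_integral_mul_comp_mul {f k : ℝ → ℂ} {w : ℂ}
    (hfm : AEStronglyMeasurable f (volume.restrict (Ioi 0))) (hkm : Continuous k)
    (hf : MellinConvergent f w) (hk : MellinConvergent k (1 - w)) :
    mellin (fun y => ∫ x in Ioi 0, f x * k (x * y)) (1 - w) = mellin f w * mellin k (1 - w) := by
  have key : ∀ x ∈ Ioi (0 : ℝ), ∫ y in Ioi (0 : ℝ), (y : ℂ) ^ (1 - w - 1) * (f x * k (x * y)) =
      (x : ℂ) ^ (w - 1) * f x * mellin k (1 - w) := by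
    intro x hx
    have := mellin_comp_mul_left k (1 - w) hx
    rw [mellin] at this
    simp only [smul_eq_mul] at this
    rw [show w - 1 = -(1 - w) by ring, mul_assoc, mul_left_comm, ← this, ← integral_const_mul]
    congr 1; ext y; ring
  have hnorm : ∀ (v : ℂ), ∀ y ∈ Ioi (0 : ℝ), ‖(y : ℂ) ^ v‖ = y ^ v.re := fun v y hy =>
    norm_cpow_eq_rpow_re_of_pos hy v
  have hmeas : AEStronglyMeasurable
      (Function.uncurry fun y x : ℝ => (y : ℂ) ^ (1 - w - 1) * (f x * k (x * y)))
      ((volume.restrict (Ioi 0)).prod (volume.restrict (Ioi 0))) := by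
    refine AEStronglyMeasurable.mul ?_ (AEStronglyMeasurable.mul ?_ ?_)
    · have : AEStronglyMeasurable (fun y : ℝ => (y : ℂ) ^ (1 - w - 1)) (volume.restrict (Ioi 0)) := by
        refine Measurable.aestronglyMeasurable ?_
        fun_prop
      exact this.comp_fst
    · exact hfm.comp_snd
    · exact (hkm.comp (continuous_snd.mul continuous_fst)).aestronglyMeasurable
  have hfi : Integrable
      (Function.uncurry fun y x : ℝ => (y : ℂ) ^ (1 - w - 1) * (f x * k (x * y)))
      ((volume.restrict (Ioi 0)).prod (volume.restrict (Ioi 0))) := by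
    rw [integrable_prod_iff' hmeas]
    constructor
    · filter_upwards [self_mem_ae_restrict measurableSet_Ioi] with x hx
      have := (MellinConvergent.comp_mul_left (f := k) (s := 1 - w) hx).2 hk
      have := Integrable.const_mul this (f x)
      refine this.congr (Filter.Eventually.of_forall fun y => ?_)
      simp only [Function.uncurry, smul_eq_mul]; ring
    · have h1 := (hf.norm).mul_const (∫ y in Ioi 0, y ^ ((1 - w).re - 1) * ‖k y‖)
      refine h1.congr ?_
      filter_upwards [self_mem_ae_restrict measurableSet_Ioi] with x hx
      have e := integral_Ioi_rpow_mul_norm_comp_mul k (1 - w).re hx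
      calc _ = ‖f x‖ * ∫ y in Ioi 0, y ^ ((1 - w).re - 1) * ‖k (x * y)‖ := by
            rw [e, norm_smul, hnorm _ x hx]
            simp only [sub_re, one_re]
            rw [show -(1 - w.re) = w.re - 1 by ring]; ring
        _ = _ := by
            rw [← integral_const_mul]
            refine setIntegral_congr_fun measurableSet_Ioi fun y hy => ?_
            simp only [Function.uncurry, norm_mul]
            rw [hnorm _ y hy]
            simp only [sub_re, one_re]
            ring
  calc mellin (fun y => ∫ x in Ioi 0, f x * k (x * y)) (1 - w)
      = ∫ y in Ioi (0 : ℝ), ∫ x in Ioi (0 : ℝ), (y : ℂ) ^ (1 - w - 1) * (f x * k (x * y)) := by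
        simp only [mellin, smul_eq_mul, integral_const_mul]
    _ = ∫ x in Ioi (0 : ℝ), ∫ y in Ioi (0 : ℝ), (y : ℂ) ^ (1 - w - 1) * (f x * k (x * y)) :=
        integral_integral_swap hfi
    _ = ∫ x in Ioi (0 : ℝ), (x : ℂ) ^ (w - 1) * f x * mellin k (1 - w) :=
        setIntegral_congr_fun measurableSet_Ioi key
    _ = _ := by rw [integral_mul_const]; rfl

lemma integral_eq_two_mul_integral_Ioi {f : ℝ → ℂ} (hf : Integrable f) (he : f.Even) :
    ∫ x, f x = 2 * ∫ x in Ioi 0, f x := by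
  rw [← intervalIntegral.integral_Iic_add_Ioi (b := 0) hf.integrableOn hf.integrableOn]
  have := integral_comp_neg_Iic 0 f
  simp only [neg_zero] at this
  rw [← this]
  simp only [he.eq]
  ring

lemma fourier_even {f : ℝ → ℂ} (he : f.Even) : (𝓕 f).Even := by
  intro x
  rw [Real.fourier_eq, Real.fourier_eq, ← integral_neg_eq_self]
  simp [he.eq]

lemma stdGaussian_even : stdGaussian.Even := fun x => by simp [stdGaussian]

lemma continuous_fourier {f : ℝ → ℂ} (hf : Integrable f) : Continuous (𝓕 f) :=
  VectorFourier.fourierIntegral_continuous Real.continuous_fourierChar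
    (L := innerₗ ℝ) continuous_inner hf

lemma norm_fourier_le (f : ℝ → ℂ) (x : ℝ) : ‖𝓕 f x‖ ≤ ∫ t, ‖f t‖ :=
  VectorFourier.norm_fourierIntegral_le_integral_norm _ _ _ _ _

lemma norm_stdGaussian_le (x : ℝ) : ‖stdGaussian x‖ ≤ 1 := by
  rw [stdGaussian, norm_exp, Real.exp_le_one_iff]
  have : (-(π : ℂ) * x ^ 2).re = -π * x ^ 2 := by norm_cast
  rw [this]
  nlinarith [Real.pi_pos, mul_nonneg Real.pi_pos.le (sq_nonneg x)]

lemma integral_fourier_mul_stdGaussian {f : ℝ → ℂ} (hf : Integrable f) (he : f.Even) {y : ℝ}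
    (hy : 0 < y) :
    ∫ x in Ioi 0, 𝓕 f x * stdGaussian (x * y)
     = (y : ℂ)⁻¹ * ∫ x in Ioi 0, f x * stdGaussian (x * y⁻¹) := by
  have hg := integrable_stdGaussian_comp_mul hy
  have h : ∫ x, 𝓕 f x * stdGaussian (x * y) = ∫ x, f x * 𝓕 (fun t => stdGaussian (t * y)) x := by
    simpa using! (VectorFourier.integral_fourierIntegral_smul_eq_flip (L := innerₗ ℝ)
      Real.continuous_fourierChar continuous_inner hf hg)
  simp only [fourier_stdGaussian_comp_mul hy] at h
  have i1 : Integrable fun x => 𝓕 f x * stdGaussian (x * y) :=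
    hg.bdd_mul (continuous_fourier hf).aestronglyMeasurable
      (Filter.Eventually.of_forall (norm_fourier_le f))
  have i2 : Integrable fun x => f x * stdGaussian (x * y⁻¹) :=
    hf.mul_bdd (c := 1) ((continuous_stdGaussian.comp (continuous_mul_const _)).aestronglyMeasurable)
      (Filter.Eventually.of_forall fun x => norm_stdGaussian_le _)
  have h' : ∫ x, 𝓕 f x * stdGaussian (x * y) =
      (y : ℂ)⁻¹ * ∫ x, f x * stdGaussian (x * y⁻¹) := by
    rw [h, ← integral_const_mul]; congr 1; ext x; ring
  rw [integral_eq_two_mul_integral_Ioi i1, integral_eq_two_mul_integral_Ioi i2] at h'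
  · linear_combination h' / 2
  · intro x; simp [he.eq, stdGaussian_even.eq]
  · intro x; simp [(fourier_even he).eq, stdGaussian_even.eq]

lemma mellin_fourier_mul_Gammaℝ {f : ℝ → ℂ} (hf : Integrable f) (he : f.Even) {s : ℂ}
    (h0 : 0 < s.re) (h1 : s.re < 1) (hm : MellinConvergent f (1 - s))
    (hmF : MellinConvergent (𝓕 f) s) :
    mellin (𝓕 f) s * Gammaℝ (1 - s) = mellin f (1 - s) * Gammaℝ s := by
  have g0 := hasMellin_stdGaussian h0
  have g1 := hasMellin_stdGaussian (s := 1 - s) (by simpa using h1)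
  have e1 := mellin_integral_mul_comp_mul (continuous_fourier hf).aestronglyMeasurable
    continuous_stdGaussian hmF g1.1
  have e2 := mellin_integral_mul_comp_mul hf.aestronglyMeasurable.restrict
    continuous_stdGaussian hm (by simpa using g0.1)
  rw [sub_sub_cancel, g0.2] at e2
  rw [g1.2] at e1
  have e3 : mellin (fun y => ∫ x in Ioi 0, 𝓕 f x * stdGaussian (x * y)) (1 - s) =
      mellin (fun y => ∫ x in Ioi 0, f x * stdGaussian (x * y)) s := by
    have a := mellin_cpow_smul (fun y : ℝ => ∫ x in Ioi 0, f x * stdGaussian (x * y⁻¹)) (1 - s) (-1)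
    have b := mellin_comp_inv (fun y : ℝ => ∫ x in Ioi 0, f x * stdGaussian (x * y)) (-s)
    rw [show 1 - s + -1 = -s by ring, b, neg_neg] at a
    rw [← a]
    refine setIntegral_congr_fun measurableSet_Ioi fun y hy => ?_
    simp only [integral_fourier_mul_stdGaussian hf he hy, cpow_neg_one, smul_eq_mul]
  linear_combination 2 * (e2 - e1 + e3)

lemma norm_integral_Ioi_mul_exp_le {u u' : ℝ → ℂ} {δ C : ℝ} (hδ0 : 0 < δ) (hδ1 : δ < 1)
    (hu : ∀ x ∈ Ioi (0 : ℝ), HasDerivAt u (u' x) x) (hui : IntegrableOn u (Ioi 0))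
    (hC : ∀ x ∈ Ioi (0 : ℝ), x ^ δ * ‖u x‖ ≤ C)
    (h1 : MellinConvergent u δ) (h2 : MellinConvergent u' (δ + 1)) {a : ℝ} (ha : a ≠ 0) :
    ‖∫ x in Ioi 0, u x * cexp (a * x * I)‖ ≤
      ((∫ x : ℝ in Ioi 0, ‖(x : ℂ) ^ ((δ : ℂ) - 1) • u x‖) + C +
        ∫ x : ℝ in Ioi 0, ‖(x : ℂ) ^ ((δ : ℂ) + 1 - 1) • u' x‖) * |a| ^ (δ - 1) := by
  set A := ∫ x : ℝ in Ioi 0, ‖(x : ℂ) ^ ((δ : ℂ) - 1) • u x‖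
  set B := ∫ x : ℝ in Ioi 0, ‖(x : ℂ) ^ ((δ : ℂ) + 1 - 1) • u' x‖
  have ha' : 0 < |a| := abs_pos.2 ha
  set ε := |a|⁻¹ with hε
  have hε0 : 0 < ε := inv_pos.2 ha'
  have hεa : |a| ^ (δ - 1) = ε ^ (1 - δ) := by
    rw [hε, Real.inv_rpow ha'.le, ← Real.rpow_neg ha'.le]; ring_nf
  have hexp : ∀ x : ℝ, ‖cexp (a * x * I)‖ = 1 := fun x => by
    have := norm_exp_ofReal_mul_I (a * x)
    push_cast at this; exact this
  have hsub : Ioi ε ⊆ Ioi 0 := Ioi_subset_Ioi hε0.le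
  have hsub' : Ioc 0 ε ⊆ Ioi 0 := Ioc_subset_Ioi_self
  have hprod : IntegrableOn (fun x : ℝ => u x * cexp (a * x * I)) (Ioi 0) :=
    Integrable.mul_bdd (c := 1) hui (by fun_prop) (Filter.Eventually.of_forall fun x => (hexp x).le)
  have hn1 : ∀ x ∈ Ioi (0 : ℝ), ‖(x : ℂ) ^ ((δ : ℂ) - 1) • u x‖ = x ^ (δ - 1) * ‖u x‖ := by
    intro x hx
    rw [norm_smul, norm_cpow_eq_rpow_re_of_pos hx]; simp
  have hn2 : ∀ x ∈ Ioi (0 : ℝ), ‖(x : ℂ) ^ ((δ : ℂ) + 1 - 1) • u' x‖ = x ^ δ * ‖u' x‖ := by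
    intro x hx
    rw [norm_smul, norm_cpow_eq_rpow_re_of_pos hx]; simp
  have hsplit : ∫ x in Ioi 0, u x * cexp (a * x * I) =
      (∫ x in Ioc 0 ε, u x * cexp (a * x * I)) + ∫ x in Ioi ε, u x * cexp (a * x * I) := by
    rw [← setIntegral_union (Ioc_disjoint_Ioi le_rfl) measurableSet_Ioi (hprod.mono_set hsub')
      (hprod.mono_set hsub), Ioc_union_Ioi_eq_Ioi hε0.le]
  have b1 : ‖∫ x in Ioc 0 ε, u x * cexp (a * x * I)‖ ≤ A * ε ^ (1 - δ) := by
    calc ‖∫ x in Ioc 0 ε, u x * cexp (a * x * I)‖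
        ≤ ∫ x : ℝ in Ioc 0 ε, ‖(x : ℂ) ^ ((δ : ℂ) - 1) • u x‖ * ε ^ (1 - δ) := by
          refine norm_integral_le_of_norm_le (IntegrableOn.mono_set (h1.norm.mul_const _) hsub') ?_
          filter_upwards [self_mem_ae_restrict measurableSet_Ioc] with x hx
          rw [norm_mul, hexp, mul_one, hn1 x hx.1, mul_right_comm]
          refine le_mul_of_one_le_left (norm_nonneg _) ?_
          have : x ^ (δ - 1) * x ^ (1 - δ) = 1 := by
            rw [← Real.rpow_add hx.1]; simp
          exact this.symm.le.trans (mul_le_mul_of_nonneg_left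
            (Real.rpow_le_rpow hx.1.le hx.2 (by linarith)) (Real.rpow_nonneg hx.1.le _))
      _ ≤ ∫ x : ℝ in Ioi 0, ‖(x : ℂ) ^ ((δ : ℂ) - 1) • u x‖ * ε ^ (1 - δ) := by
          refine setIntegral_mono_set (h1.norm.mul_const _) ?_ hsub'.eventuallyLE
          exact Filter.Eventually.of_forall fun x => by positivity
      _ = _ := by rw [integral_mul_const]
  have hεneg : ∀ x ∈ Ioi ε, x ^ (-δ) ≤ ε ^ (-δ) := fun x hx =>
    Real.rpow_le_rpow_of_nonpos hε0 (le_of_lt hx) (by linarith)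
  have hxx : ∀ x ∈ Ioi (0 : ℝ), x ^ (-δ) * x ^ δ = 1 := fun x hx => by
    rw [← Real.rpow_add hx]; simp
  have hle : ∀ x ∈ Ioi ε, ‖u' x‖ ≤ ε ^ (-δ) * ‖(x : ℂ) ^ ((δ : ℂ) + 1 - 1) • u' x‖ := by
    intro x hx
    have hx0 : 0 < x := hε0.trans hx
    rw [hn2 x hx0, ← mul_assoc]
    refine le_mul_of_one_le_left (norm_nonneg _) ?_
    exact (hxx x hx0).symm.le.trans
      (mul_le_mul_of_nonneg_right (hεneg x hx) (Real.rpow_nonneg hx0.le δ))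
  have hu'i : IntegrableOn u' (Ioi ε) := by
    have m : AEStronglyMeasurable u' (volume.restrict (Ioi ε)) := by
      have m1 := (IntegrableOn.mono_set h2 hsub).aestronglyMeasurable
      have m2 : AEStronglyMeasurable (fun x : ℝ => (x : ℂ) ^ (-(δ : ℂ)))
          (volume.restrict (Ioi ε)) := by
        refine Measurable.aestronglyMeasurable ?_
        fun_prop
      refine (m2.mul m1).congr ?_
      filter_upwards [self_mem_ae_restrict measurableSet_Ioi] with x hx
      have hx0 : (x : ℂ) ≠ 0 := by exact_mod_cast (hε0.trans hx).ne'
      simp only [Pi.mul_apply, smul_eq_mul, ← mul_assoc]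
      rw [← cpow_add _ _ hx0]; simp
    refine ((IntegrableOn.mono_set h2 hsub).norm.const_mul (ε ^ (-δ))).mono' m ?_
    filter_upwards [self_mem_ae_restrict measurableSet_Ioi] with x hx using hle x hx
  have haI : (a : ℂ) * I ≠ 0 := by simp [ha]
  have hv : ∀ x : ℝ, HasDerivAt (fun x : ℝ => cexp (a * x * I) / (a * I)) (cexp (a * x * I)) x := by
    intro x
    have : HasDerivAt (fun x : ℝ => (a : ℂ) * x * I) (a * I) x := by
      simpa using! ((ofRealCLM.hasDerivAt (x := x)).const_mul (a : ℂ)).mul_const I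
    have := this.cexp.div_const (a * I)
    rwa [mul_div_cancel_right₀ _ haI] at this
  have hvn : ∀ x : ℝ, ‖cexp (a * x * I) / (a * I)‖ = ε := fun x => by
    rw [norm_div, hexp]; simp [hε]
  have htop : Filter.Tendsto (fun x : ℝ => u x * (cexp (a * x * I) / (a * I))) Filter.atTop
      (nhds 0) := by
    have t1 : Filter.Tendsto (fun x : ℝ => C * x ^ (-δ) * ε) Filter.atTop (nhds 0) := by
      simpa using! ((tendsto_rpow_neg_atTop hδ0).const_mul C).mul_const ε
    refine squeeze_zero_norm' ?_ t1
    filter_upwards [Filter.eventually_gt_atTop 0] with x hx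
    rw [norm_mul, hvn]
    gcongr
    calc ‖u x‖ = x ^ (-δ) * (x ^ δ * ‖u x‖) := by rw [← mul_assoc, hxx x hx, one_mul]
      _ ≤ x ^ (-δ) * C := by
        have := Real.rpow_nonneg hx.le (-δ)
        gcongr
        exact hC x hx
      _ = _ := mul_comm _ _
  have hbot : Filter.Tendsto (fun x : ℝ => u x * (cexp (a * x * I) / (a * I)))
      (nhdsWithin ε (Ioi ε)) (nhds (u ε * (cexp (a * ε * I) / (a * I)))) :=
    ((hu ε hε0).continuousAt.mul (hv ε).continuousAt).tendsto.mono_left nhdsWithin_le_nhds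
  have hu'v : IntegrableOn (u' * fun x : ℝ => cexp (a * x * I) / (a * I)) (Ioi ε) :=
    Integrable.mul_bdd (c := ε) hu'i (by fun_prop) (Filter.Eventually.of_forall fun x => (hvn x).le)
  have hparts := integral_Ioi_mul_deriv_eq_deriv_mul (fun x hx => hu x (hsub hx))
    (fun x _ => hv x) (hprod.mono_set hsub) hu'v hbot htop
  have b2 : ‖u ε * (cexp (a * ε * I) / (a * I))‖ ≤ C * ε ^ (1 - δ) := by
    rw [norm_mul, hvn]
    calc ‖u ε‖ * ε = (ε ^ δ * ‖u ε‖) * ε ^ (1 - δ) := by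
          rw [mul_right_comm, ← Real.rpow_add hε0]; simp [mul_comm]
      _ ≤ C * ε ^ (1 - δ) := by
          gcongr
          exact hC ε hε0
  have b3 : ‖∫ x in Ioi ε, u' x * (cexp (a * x * I) / (a * I))‖ ≤ B * ε ^ (1 - δ) := by
    calc ‖∫ x in Ioi ε, u' x * (cexp (a * x * I) / (a * I))‖
        ≤ ∫ x : ℝ in Ioi ε, ‖(x : ℂ) ^ ((δ : ℂ) + 1 - 1) • u' x‖ * ε ^ (1 - δ) := by
          refine norm_integral_le_of_norm_le (IntegrableOn.mono_set (h2.norm.mul_const _) hsub) ?_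
          filter_upwards [self_mem_ae_restrict measurableSet_Ioi] with x hx
          rw [norm_mul, hvn]
          calc ‖u' x‖ * ε ≤ (ε ^ (-δ) * ‖(x : ℂ) ^ ((δ : ℂ) + 1 - 1) • u' x‖) * ε := by
                gcongr
                exact hle x hx
            _ = _ := by
                rw [show (1 - δ) = -δ + 1 by ring, Real.rpow_add hε0, Real.rpow_one]; ring
      _ ≤ ∫ x : ℝ in Ioi 0, ‖(x : ℂ) ^ ((δ : ℂ) + 1 - 1) • u' x‖ * ε ^ (1 - δ) := by
          refine setIntegral_mono_set (h2.norm.mul_const _) ?_ hsub.eventuallyLE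
          exact Filter.Eventually.of_forall fun x => by positivity
      _ = _ := by rw [integral_mul_const]
  rw [hsplit, hparts, hεa]
  calc _ ≤ ‖∫ x in Ioc 0 ε, u x * cexp (a * x * I)‖ + (‖u ε * (cexp (a * ε * I) / (a * I))‖
        + ‖∫ x in Ioi ε, u' x * (cexp (a * x * I) / (a * I))‖) := by
        refine (norm_add_le _ _).trans ?_
        gcongr
        refine (norm_sub_le _ _).trans ?_
        rw [zero_sub, norm_neg]
    _ ≤ _ := by linarith

lemma integrable_of_even {f : ℝ → ℂ} (he : f.Even) (hf : IntegrableOn f (Ioi 0)) :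
    Integrable f := by
  rw [← integrableOn_univ, ← Iic_union_Ioi (a := (0 : ℝ)), integrableOn_union,
    integrableOn_Iic_iff_integrableOn_Iio]
  refine ⟨?_, hf⟩
  have := (integrable_indicator_iff measurableSet_Ioi).2 hf
  rw [← integrable_indicator_iff measurableSet_Iio]
  refine this.comp_neg.congr (Filter.Eventually.of_forall fun x => ?_)
  simp [indicator, he.eq]

lemma exists_norm_fourier_le_rpow {u u' : ℝ → ℂ} {δ C : ℝ} (hδ0 : 0 < δ) (hδ1 : δ < 1)
    (he : u.Even)
    (hu : ∀ x ∈ Ioi (0 : ℝ), HasDerivAt u (u' x) x) (hui : Integrable u)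
    (hC : ∀ x ∈ Ioi (0 : ℝ), x ^ δ * ‖u x‖ ≤ C)
    (h1 : MellinConvergent u δ) (h2 : MellinConvergent u' (δ + 1)) :
    ∃ M, ∀ y : ℝ, 0 < y → ‖𝓕 u y‖ ≤ M * y ^ (δ - 1) := by
  set A := (∫ x : ℝ in Ioi 0, ‖(x : ℂ) ^ ((δ : ℂ) - 1) • u x‖) + C +
        ∫ x : ℝ in Ioi 0, ‖(x : ℂ) ^ ((δ : ℂ) + 1 - 1) • u' x‖ with hA
  refine ⟨A * (2 * π) ^ (δ - 1) + A * (2 * π) ^ (δ - 1), fun y hy => ?_⟩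
  have e : 𝓕 u y = (∫ x in Ioi 0, u x * cexp ((2 * π * y : ℝ) * x * I)) +
      ∫ x in Ioi 0, u x * cexp ((-(2 * π * y) : ℝ) * x * I) := by
    have hi : Integrable (fun x : ℝ => u x * cexp ((-(2 * π * y) : ℝ) * x * I)) :=
      Integrable.mul_bdd (c := 1) hui (by fun_prop) (Filter.Eventually.of_forall fun x => by
        have := norm_exp_ofReal_mul_I (-(2 * π * y) * x)
        rw [ofReal_mul] at this; exact this.le)
    have e0 : 𝓕 u y = ∫ x : ℝ, u x * cexp ((-(2 * π * y) : ℝ) * x * I) := by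
      rw [Real.fourier_real_eq_integral_exp_smul]
      congr 1; ext x
      rw [smul_eq_mul, mul_comm]
      congr 2
      push_cast; ring
    rw [e0, ← intervalIntegral.integral_Iic_add_Ioi (b := 0) hi.integrableOn hi.integrableOn]
    congr 1
    have := integral_comp_neg_Iic 0 (fun x : ℝ => u x * cexp ((2 * π * y : ℝ) * x * I))
    rw [neg_zero] at this
    rw [← this]
    congr 1; ext x
    rw [he.eq]; congr 2; push_cast; ring
  have hpy : (2 * π * y) ≠ 0 := by positivity
  have n1 := norm_integral_Ioi_mul_exp_le hδ0 hδ1 hu hui.integrableOn hC h1 h2 hpy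
  have n2 := norm_integral_Ioi_mul_exp_le hδ0 hδ1 hu hui.integrableOn hC h1 h2 (neg_ne_zero.2 hpy)
  rw [abs_neg] at n2
  rw [abs_of_pos (by positivity), Real.mul_rpow (by positivity) hy.le, ← mul_assoc, ← hA] at n1 n2
  rw [e]
  refine (norm_add_le _ _).trans ((add_le_add n1 n2).trans_eq ?_)
  rw [← add_mul]

open scoped SchwartzMap in
lemma SchwartzMap.mellinConvergent_and_hasDerivAt_mellin (S : 𝓢(ℝ, ℂ)) {s : ℂ} (hs : 0 < s.re) :
    MellinConvergent S s ∧ MellinConvergent (fun t => Real.log t • S t) s ∧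
      HasDerivAt (mellin S) (mellin (fun t => Real.log t • S t) s) s := by
  have hc : LocallyIntegrableOn S (Ioi 0) :=
    S.continuous.locallyIntegrable.locallyIntegrableOn _
  have htop : S =O[Filter.atTop] fun x : ℝ => x ^ (-(s.re + 1)) := by
    refine ((S.isBigO_cocompact_rpow (-(s.re + 1))).mono atTop_le_cocompact).trans ?_
    refine Filter.EventuallyEq.isBigO ?_
    filter_upwards [Filter.eventually_ge_atTop 0] with x hx
    rw [Real.norm_of_nonneg hx]
  have hbot : S =O[nhdsWithin 0 (Ioi 0)] fun x : ℝ => x ^ (-(0 : ℝ)) := by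
    simp only [neg_zero, Real.rpow_zero]
    exact (S.continuous.continuousAt.tendsto.isBigO_one ℝ).mono nhdsWithin_le_nhds
  exact ⟨mellinConvergent_of_isBigO_rpow hc htop (by linarith) hbot hs,
    mellin_hasDerivAt_of_isBigO_rpow hc htop (by linarith) hbot hs⟩

lemma rpow_mul_abs_log_le {δ x : ℝ} (hδ0 : 0 < δ) (hδ1 : δ < 1) (hx : 0 < x) :
    x ^ δ * |Real.log x| ≤ (2 + x ^ 2) / δ := by
  have h1 := Real.log_le_rpow_div hx.le hδ0
  have h2 := Real.log_le_rpow_div (inv_pos.2 hx).le hδ0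
  rw [Real.log_inv, Real.inv_rpow hx.le] at h2
  have hp := Real.rpow_pos_of_pos hx δ
  have h3 : |Real.log x| ≤ (x ^ δ + (x ^ δ)⁻¹) / δ := by
    rw [add_div]
    have : 0 < x ^ δ / δ := by positivity
    have : 0 < (x ^ δ)⁻¹ / δ := by positivity
    exact abs_le.2 ⟨by linarith, by linarith⟩
  have h4 : x ^ δ * x ^ δ ≤ 1 + x ^ 2 := by
    rw [← Real.rpow_add hx]
    rcases le_total x 1 with h | h
    · have := Real.rpow_le_one hx.le h (z := δ + δ) (by linarith)
      nlinarith
    · have := Real.rpow_le_rpow_of_exponent_le h (show δ + δ ≤ 2 by linarith)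
      rw [Real.rpow_two] at this
      linarith
  calc x ^ δ * |Real.log x| ≤ x ^ δ * ((x ^ δ + (x ^ δ)⁻¹) / δ) := by gcongr
    _ = (x ^ δ * x ^ δ + 1) / δ := by field_simp
    _ ≤ _ := div_le_div_of_nonneg_right (by linarith) hδ0.le

open scoped SchwartzMap in
lemma SchwartzMap.exists_two_add_sq_mul_norm_le (S : 𝓢(ℝ, ℂ)) : ∃ C, ∀ x, (2 + x ^ 2) * ‖S x‖ ≤ C := by
  obtain ⟨C, -, hC⟩ := S.decay 2 0
  obtain ⟨D, -, hD⟩ := S.decay 0 0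
  refine ⟨2 * D + C, fun x => ?_⟩
  have a := hC x
  have b := hD x
  simp only [norm_iteratedFDeriv_zero, pow_zero, one_mul, Real.norm_eq_abs, sq_abs] at a b
  linarith

lemma even_log_mul {S : ℝ → ℂ} (he : S.Even) :
    (fun x : ℝ => (Real.log x : ℂ) * S x).Even := fun x => by
  simp [he.eq, Real.log_neg_eq_log]

open scoped SchwartzMap in
lemma SchwartzMap.integrable_log_mul (S : 𝓢(ℝ, ℂ)) (he : Function.Even S) :
    Integrable (fun x : ℝ => (Real.log x : ℂ) * S x) := by
  refine integrable_of_even (even_log_mul he) ?_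
  have := (S.mellinConvergent_and_hasDerivAt_mellin (s := 1) (by simp)).2.1
  simpa [MellinConvergent] using this

open scoped SchwartzMap in
lemma SchwartzMap.mellinConvergent_fourier_log_mul (S : 𝓢(ℝ, ℂ)) (he : Function.Even S) {s : ℂ}
    (h0 : 0 < s.re) (h1 : s.re < 1) :
    MellinConvergent (𝓕 (fun x : ℝ => (Real.log x : ℂ) * S x)) s := by
  set u : ℝ → ℂ := fun x : ℝ => (Real.log x : ℂ) * S x with hu
  have hui := S.integrable_log_mul he
  set δ : ℝ := (1 - s.re) / 2
  have hδ0 : 0 < δ := by simp only [δ]; linarith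
  have hδ1 : δ < 1 := by simp only [δ]; linarith
  have hδs : s.re < 1 - δ := by simp only [δ]; linarith
  have hder : ∀ x ∈ Ioi (0 : ℝ), HasDerivAt u
      ((x : ℂ) ^ (-1 : ℂ) • S x + Real.log x • deriv S x) x := by
    intro x hx
    have := (Real.hasDerivAt_log (ne_of_gt hx)).ofReal_comp.mul (S.hasDerivAt x)
    simpa [cpow_neg_one] using! this
  have hmu : ∀ a : ℝ, 0 < a → MellinConvergent u a := fun a ha => by
    simpa using (S.mellinConvergent_and_hasDerivAt_mellin (s := a) (by simpa)).2.1
  have hmu' : MellinConvergent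
      (fun x : ℝ => (x : ℂ) ^ (-1 : ℂ) • S x + Real.log x • deriv S x) (δ + 1) := by
    refine (hasMellin_add ?_ ?_).1
    · rw [MellinConvergent.cpow_smul]
      simpa using (S.mellinConvergent_and_hasDerivAt_mellin (s := δ) (by simpa)).1
    · exact ((SchwartzMap.derivCLM ℝ ℂ S).mellinConvergent_and_hasDerivAt_mellin
        (s := δ + 1) (by simp; positivity)).2.1
  obtain ⟨C, hC⟩ := S.exists_two_add_sq_mul_norm_le
  have hb : ∀ x ∈ Ioi (0 : ℝ), x ^ δ * ‖u x‖ ≤ C / δ := by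
    intro x hx
    rw [hu, norm_mul, norm_real, Real.norm_eq_abs, ← mul_assoc]
    calc x ^ δ * |Real.log x| * ‖S x‖ ≤ (2 + x ^ 2) / δ * ‖S x‖ := by
          gcongr
          exact rpow_mul_abs_log_le hδ0 hδ1 hx
      _ = ((2 + x ^ 2) * ‖S x‖) / δ := by ring
      _ ≤ _ := by gcongr; exact hC x
  obtain ⟨M, hM⟩ := exists_norm_fourier_le_rpow hδ0 hδ1 (even_log_mul he) hder hui hb
    (hmu δ hδ0) hmu'
  refine mellinConvergent_of_isBigO_rpow (a := 1 - δ) (b := 0)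
    ((continuous_fourier hui).locallyIntegrable.locallyIntegrableOn _) ?_ hδs ?_ h0
  · refine Asymptotics.IsBigO.of_bound M ?_
    filter_upwards [Filter.eventually_gt_atTop 0] with y hy
    rw [Real.norm_of_nonneg (Real.rpow_nonneg hy.le _), neg_sub]
    exact hM y hy
  · simp only [neg_zero, Real.rpow_zero]
    exact ((continuous_fourier hui).continuousAt.tendsto.isBigO_one ℝ).mono nhdsWithin_le_nhds

lemma GammaR_eq : GammaR = fun s => (Gammaℝ (1 - s))⁻¹ / (Gammaℝ s)⁻¹ := by
  ext s
  have hπ : (π : ℂ) ≠ 0 := by exact_mod_cast Real.pi_ne_zero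
  rw [GammaR, Gammaℝ_def, Gammaℝ_def, div_inv_eq_mul, mul_inv, ← cpow_neg,
    show (1 / 2 - s : ℂ) = -(-(1 - s) / 2) + -s / 2 by ring, cpow_add _ _ hπ]
  ring

lemma GammaR_ne_zero {s : ℂ} (h0 : 0 < s.re) (h1 : s.re < 1) : GammaR s ≠ 0 := by
  rw [GammaR_eq]
  exact div_ne_zero (inv_ne_zero (Gammaℝ_ne_zero_of_re_pos (by simpa using h1)))
    (inv_ne_zero (Gammaℝ_ne_zero_of_re_pos h0))

lemma GammaR_mul_GammaR_one_sub {s : ℂ} (h0 : 0 < s.re) (h1 : s.re < 1) :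
    GammaR s * GammaR (1 - s) = 1 := by
  have a : Gammaℝ (1 - s) ≠ 0 := Gammaℝ_ne_zero_of_re_pos (by simpa using h1)
  have b := Gammaℝ_ne_zero_of_re_pos h0
  simp only [GammaR_eq, sub_sub_cancel]
  field_simp

lemma differentiableAt_GammaR {s : ℂ} (h0 : 0 < s.re) : DifferentiableAt ℂ GammaR s := by
  rw [GammaR_eq]
  refine DifferentiableAt.div ?_ (differentiable_Gammaℝ_inv s)
    (inv_ne_zero (Gammaℝ_ne_zero_of_re_pos h0))
  exact (differentiable_Gammaℝ_inv (1 - s)).comp s (by fun_prop)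

lemma isOpen_reStrip : IsOpen {s : ℂ | 0 < s.re ∧ s.re < 1} :=
  (isOpen_lt continuous_const continuous_re).inter (isOpen_lt continuous_re continuous_const)

lemma continuousOn_LambdaR : ContinuousOn LambdaR {s : ℂ | 0 < s.re ∧ s.re < 1} := by
  have hd : DifferentiableOn ℂ GammaR {s : ℂ | 0 < s.re ∧ s.re < 1} := fun s hs =>
    (differentiableAt_GammaR hs.1).differentiableWithinAt
  exact ((hd.deriv isOpen_reStrip).continuousOn.div hd.continuousOn
    fun s hs => GammaR_ne_zero hs.1 hs.2).neg

lemma deriv_GammaR_mul_GammaR_one_sub {s : ℂ} (h0 : 0 < s.re) (h1 : s.re < 1) :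
    deriv GammaR s * GammaR (1 - s) = GammaR s * deriv GammaR (1 - s) := by
  have d0 := (differentiableAt_GammaR h0).hasDerivAt
  have d1 := (differentiableAt_GammaR (s := 1 - s) (by simpa using h1)).hasDerivAt
  have d2 := d0.mul (d1.comp_const_sub 1 s)
  have d3 : HasDerivAt (fun s => GammaR s * GammaR (1 - s)) 0 s := by
    refine (hasDerivAt_const s (1 : ℂ)).congr_of_eventuallyEq ?_
    filter_upwards [isOpen_reStrip.mem_nhds ⟨h0, h1⟩] with z hz
    exact GammaR_mul_GammaR_one_sub hz.1 hz.2
  have := d2.unique d3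
  linear_combination this

lemma mellin_fourier {f : ℝ → ℂ} (hf : Integrable f) (he : f.Even) {s : ℂ} (h0 : 0 < s.re)
    (h1 : s.re < 1) (hm : MellinConvergent f (1 - s)) (hmF : MellinConvergent (𝓕 f) s) :
    mellin (𝓕 f) s = GammaR s * mellin f (1 - s) := by
  have h := mellin_fourier_mul_Gammaℝ hf he h0 h1 hm hmF
  have a : Gammaℝ (1 - s) ≠ 0 := Gammaℝ_ne_zero_of_re_pos (by simpa using h1)
  have b := Gammaℝ_ne_zero_of_re_pos h0
  simp only [GammaR_eq]
  field_simp
  linear_combination h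

open scoped SchwartzMap in
lemma SchwartzMap.hasMellin_fourier_log_mul_fourier (S : 𝓢(ℝ, ℂ)) (he : Function.Even S) {s : ℂ}
    (h0 : 0 < s.re) (h1 : s.re < 1) :
    HasMellin (fun y : ℝ => -((Real.log y : ℂ) * S y) -
        𝓕 (fun x : ℝ => (Real.log x : ℂ) * 𝓕 (S : ℝ → ℂ) x) y)
      s (LambdaR s * mellin S s) := by
  have h0' : 0 < (1 - s).re := by simpa using h1
  have h1' : (1 - s).re < 1 := by simpa using h0
  set F : 𝓢(ℝ, ℂ) := 𝓕 S
  have hF : 𝓕 (S : ℝ → ℂ) = F := rfl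
  rw [hF]
  have heF : Function.Even F := fourier_even he
  have m1 : MellinConvergent (fun y : ℝ => -((Real.log y : ℂ) * S y)) s := by
    simpa using (S.mellinConvergent_and_hasDerivAt_mellin h0).2.1.const_smul (-1 : ℂ)
  have m2 := F.mellinConvergent_fourier_log_mul heF h0 h1
  have hm := hasMellin_sub m1 m2
  refine ⟨hm.1, hm.2.trans ?_⟩
  have e1 : mellin (fun y : ℝ => -((Real.log y : ℂ) * S y)) s =
      -mellin (fun t => Real.log t • S t) s := by
    simp [mellin, integral_neg]
  have e2 := mellin_fourier (F.integrable_log_mul heF) (even_log_mul heF) h0 h1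
    (by simpa using (F.mellinConvergent_and_hasDerivAt_mellin h0').2.1) m2
  have e3 : mellin (fun x : ℝ => (Real.log x : ℂ) * F x) (1 - s) =
      deriv GammaR (1 - s) * mellin S s -
        GammaR (1 - s) * mellin (fun t => Real.log t • S t) s := by
    have d := (F.mellinConvergent_and_hasDerivAt_mellin h0').2.2
    have d1 := (S.mellinConvergent_and_hasDerivAt_mellin (s := 1 - (1 - s)) (by simpa using h0)).2.2
    have d2 := (differentiableAt_GammaR h0').hasDerivAt.mul (d1.comp_const_sub 1 (1 - s))
    have d3 := d2.congr_of_eventuallyEq (f₁ := mellin F) (by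
      filter_upwards [isOpen_reStrip.mem_nhds ⟨h0', h1'⟩] with z hz
      exact mellin_fourier S.integrable he hz.1 hz.2
        (S.mellinConvergent_and_hasDerivAt_mellin (by simpa using hz.2)).1
        (F.mellinConvergent_and_hasDerivAt_mellin hz.1).1)
    have := d.unique d3
    simp only [sub_sub_cancel, real_smul] at this ⊢
    rw [this]; ring
  rw [e1, e2]
  change _ - GammaR s * mellin (fun x : ℝ => (Real.log x : ℂ) * F x) (1 - s) = _
  rw [e3, LambdaR]
  have g1 := GammaR_mul_GammaR_one_sub h0 h1
  have g2 := deriv_GammaR_mul_GammaR_one_sub h0 h1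
  have g3 := GammaR_ne_zero h0 h1
  have g4 : deriv GammaR s / GammaR s = GammaR s * deriv GammaR (1 - s) := by
    rw [div_eq_iff g3]
    linear_combination GammaR s * g2 - deriv GammaR s * g1
  rw [g4]
  linear_combination mellin (fun t => Real.log t • S t) s * g1

lemma even_comp_abs (g : ℝ → ℂ) : (fun t : ℝ => g |t|).Even := fun t => by simp

lemma eq_zero_of_tsupport_subset_Ioi {g : ℝ → ℂ} (h : tsupport g ⊆ Ioi 0) {x : ℝ} (hx : x ≤ 0) :
    g x = 0 := by
  by_contra hne
  exact absurd (h (subset_tsupport g hne)) (not_lt.2 hx)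

lemma comp_abs_eq_add {g : ℝ → ℂ} (h : tsupport g ⊆ Ioi 0) (t : ℝ) : g |t| = g t + g (-t) := by
  rcases le_total 0 t with ht | ht
  · rw [abs_of_nonneg ht, eq_zero_of_tsupport_subset_Ioi h (neg_nonpos.2 ht), add_zero]
  · rw [abs_of_nonpos ht, eq_zero_of_tsupport_subset_Ioi h ht, zero_add]

open scoped SchwartzMap in
lemma exists_schwartzMap_eq_comp_abs {g : ℝ → ℂ} (hsm : ContDiff ℝ (⊤ : ℕ∞) g)
    (hc : HasCompactSupport g) (h : tsupport g ⊆ Ioi 0) :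
    ∃ S : 𝓢(ℝ, ℂ), (S : ℝ → ℂ) = fun t => g |t| := by
  have e : (fun t : ℝ => g |t|) = fun t => g t + g (-t) := funext (comp_abs_eq_add h)
  rw [e]
  have hc' : HasCompactSupport fun t => g (-t) := hc.comp_homeomorph (Homeomorph.neg ℝ)
  exact ⟨(hc.add hc').toSchwartzMap (hsm.add (hsm.comp contDiff_neg)), rfl⟩

lemma mellin_comp_abs (g : ℝ → ℂ) : mellin (fun t : ℝ => g |t|) = mellin g := by
  ext s
  refine setIntegral_congr_fun measurableSet_Ioi fun t ht => ?_
  simp only [abs_of_pos (mem_Ioi.1 ht)]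

lemma exists_norm_LambdaR_mul_mellin_le {g : ℝ → ℂ} (hsm : ContDiff ℝ (⊤ : ℕ∞) g)
    (hc : HasCompactSupport g) (h : tsupport g ⊆ Ioi 0) {c : ℝ} (hc0 : 0 < c) (hc1 : c < 1) :
    ∃ B, ∀ τ : ℝ, ‖LambdaR (c + τ * I) * mellin g (c + τ * I)‖ ≤ B := by
  obtain ⟨S, hS⟩ := exists_schwartzMap_eq_comp_abs hsm hc h
  have he : Function.Even S := hS ▸ even_comp_abs g
  set K : ℝ → ℂ := fun y : ℝ => -((Real.log y : ℂ) * S y) -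
    𝓕 (fun x : ℝ => (Real.log x : ℂ) * 𝓕 (S : ℝ → ℂ) x) y
  refine ⟨∫ x in Ioi 0, x ^ (c - 1) * ‖K x‖, fun τ => ?_⟩
  rw [← mellin_comp_abs, ← hS,
    ← (S.hasMellin_fourier_log_mul_fourier he (s := c + τ * I) (by simpa) (by simpa)).2, mellin]
  refine (norm_integral_le_integral_norm _).trans_eq ?_
  refine setIntegral_congr_fun measurableSet_Ioi fun x hx => ?_
  simp [norm_cpow_eq_rpow_re_of_pos hx, K]

lemma mellin_neg_mul_deriv {g : ℝ → ℂ} (hsm : ContDiff ℝ (⊤ : ℕ∞) g)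
    (hc : HasCompactSupport g) (h : tsupport g ⊆ Ioi 0) {s : ℂ} (hs : 0 < s.re) :
    mellin (fun x : ℝ => -((x : ℂ) * deriv g x)) s = s * mellin g s := by
  have hs0 : s ≠ 0 := fun e => by simp [e] at hs
  let S := hc.toSchwartzMap hsm
  have hg : (S : ℝ → ℂ) = g := rfl
  have m0 : MellinConvergent g s := (S.mellinConvergent_and_hasDerivAt_mellin hs).1
  have m1 : MellinConvergent (deriv g) (s + 1) :=
    ((SchwartzMap.derivCLM ℝ ℂ S).mellinConvergent_and_hasDerivAt_mellin
      (s := s + 1) (by simp; positivity)).1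
  have hz : g =ᶠ[nhds 0] 0 := notMem_tsupport_iff_eventuallyEq.1 fun h0 => (mem_Ioi.1 (h h0)).false
  have hinf : g =ᶠ[Filter.atTop] 0 :=
    (hasCompactSupport_iff_eventuallyEq.1 hc).filter_mono
      (Filter.coclosedCompact_eq_cocompact (X := ℝ) ▸ atTop_le_cocompact)
  have key := integral_Ioi_mul_deriv_eq_deriv_mul (a := 0) (a' := 0) (b' := 0)
    (u := fun x : ℝ => (x : ℂ) ^ s) (u' := fun x : ℝ => s * (x : ℂ) ^ (s - 1))
    (v := g) (v' := deriv g) (fun x hx => ?_)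
    (fun x _ => (hsm.differentiable (by simp) x).hasDerivAt) ?_ ?_ ?_ ?_
  · simp only [mellin, smul_eq_mul]
    have e1 : ∫ x : ℝ in Ioi 0, (x : ℂ) ^ (s - 1) * -((x : ℂ) * deriv g x) =
        -∫ x : ℝ in Ioi 0, (x : ℂ) ^ s * deriv g x := by
      rw [← integral_neg]
      refine setIntegral_congr_fun measurableSet_Ioi fun x hx => ?_
      have hx0 : (x : ℂ) ≠ 0 := by exact_mod_cast (ne_of_gt hx)
      simp only [cpow_sub _ _ hx0, cpow_one]
      field_simp
    rw [e1, key, ← integral_const_mul]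
    simp [mul_assoc]
  · exact hasDerivAt_ofReal_cpow_const (ne_of_gt hx) hs0
  · simpa [MellinConvergent, Pi.mul_def] using m1
  · have := m0.const_smul s
    simpa [MellinConvergent, Pi.mul_def, mul_assoc, mul_left_comm] using this
  · refine tendsto_const_nhds.congr' ?_
    filter_upwards [hz.filter_mono nhdsWithin_le_nhds] with x hx
    simp [hx]
  · refine tendsto_const_nhds.congr' ?_
    filter_upwards [hinf] with x hx
    simp [hx]

lemma verticalIntegrable_LambdaR_mul_mellin {g : ℝ → ℂ} (hsm : ContDiff ℝ (⊤ : ℕ∞) g)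
    (hc : HasCompactSupport g) (h : tsupport g ⊆ Ioi 0) {c : ℝ} (hc0 : 0 < c) (hc1 : c < 1) :
    VerticalIntegrable (fun s => LambdaR s * mellin g s) c := by
  have step : ∀ f : ℝ → ℂ, ContDiff ℝ (⊤ : ℕ∞) f → HasCompactSupport f → tsupport f ⊆ Ioi 0 →
      ContDiff ℝ (⊤ : ℕ∞) (fun x : ℝ => -((x : ℂ) * deriv f x)) ∧
      HasCompactSupport (fun x : ℝ => -((x : ℂ) * deriv f x)) ∧
      tsupport (fun x : ℝ => -((x : ℂ) * deriv f x)) ⊆ Ioi 0 := by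
    intro f h1 h2 h3
    have e : (fun x : ℝ => -((x : ℂ) * deriv f x)) = fun x : ℝ => (-(x : ℂ)) * deriv f x := by
      ext; ring
    rw [e]
    refine ⟨(ofRealCLM.contDiff.neg).mul (contDiff_infty_iff_deriv.1 h1).2, h2.deriv.mul_left,
      ((tsupport_mul_subset_right).trans tsupport_deriv_subset).trans h3⟩
  obtain ⟨a1, a2, a3⟩ := step g hsm hc h
  obtain ⟨b1, b2, b3⟩ := step _ a1 a2 a3
  obtain ⟨B, hB⟩ := exists_norm_LambdaR_mul_mellin_le b1 b2 b3 hc0 hc1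
  have hcont : Continuous fun τ : ℝ =>
      LambdaR (c + τ * I) * mellin g (c + τ * I) := by
    refine Continuous.mul ?_ ?_
    · exact continuousOn_LambdaR.comp_continuous (by fun_prop) fun τ => by simp [hc0, hc1]
    · refine continuous_iff_continuousAt.2 fun τ => ?_
      have := ((hc.toSchwartzMap hsm).mellinConvergent_and_hasDerivAt_mellin
        (s := c + τ * I) (by simpa)).2.2.continuousAt
      exact ContinuousAt.comp (g := mellin g) this (by fun_prop)
  refine ((integrable_inv_one_add_sq.const_mul (B / c ^ 2)).mono' hcont.aestronglyMeasurable
    (.of_forall fun τ => ?_))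
  have hre : 0 < (c + τ * I : ℂ).re := by simpa
  have hb := hB τ
  rw [mellin_neg_mul_deriv a1 a2 a3 hre, mellin_neg_mul_deriv hsm hc h hre] at hb
  set N := ‖LambdaR (c + τ * I) * mellin g (c + τ * I)‖ with hN
  have hs : ‖(c + τ * I : ℂ)‖ ^ 2 = c ^ 2 + τ ^ 2 := by
    rw [← normSq_eq_norm_sq, normSq_add_mul_I]
  have hb' : N * (c ^ 2 + τ ^ 2) ≤ B := by
    rw [← hs, hN]
    refine le_of_eq_of_le ?_ hb
    simp only [norm_mul]
    ring
  have hN0 : 0 ≤ N := norm_nonneg _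
  have h3 : N * (c ^ 2 * (1 + τ ^ 2)) ≤ B := by
    refine le_trans ?_ hb'
    gcongr
    nlinarith [mul_nonneg (sq_nonneg τ) (show 0 ≤ 1 - c ^ 2 by nlinarith)]
  rw [← div_eq_mul_inv, div_div, le_div_iff₀ (by positivity)]
  exact h3

/-- **Haran's theorem at the real place (adelic derivation of the archimedean term).**
For `g : (0,∞) → ℂ` smooth and compactly supported, `g_r(t) = g(|t|)`, `0 < c < 1` and
`y ≠ 0`:
`(1/2π) ∫_ℝ Λ_r(c+iτ) ĝ(c+iτ) |y|^{-(c+iτ)} dτ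
  = -log|y|·g(|y|) + 𝓕( x ↦ -log|x|·(𝓕⁻¹g_r)(x) )(y)`,
the left-hand integral converging absolutely and `x ↦ log|x|·(𝓕⁻¹g_r)(x)` being
integrable. -/
theorem haran_theorem_real_place (g : ℝ → ℂ)
    (hgsm : ContDiff ℝ (⊤ : ℕ∞) g) (hgs : HasCompactSupport g) (hgsupp : tsupport g ⊆ Ioi 0)
    (c : ℝ) (hc0 : 0 < c) (hc1 : c < 1) (y : ℝ) (hy : y ≠ 0) :
    Integrable
      (fun τ : ℝ =>
        LambdaR (c + τ * I) * mellin g (c + τ * I) * ((|y| : ℝ) : ℂ) ^ (-(c + τ * I))) ∧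
    Integrable (fun x : ℝ => ((Real.log |x| : ℝ) : ℂ) * 𝓕⁻ (fun t : ℝ => g |t|) x) ∧
    (1 / (2 * (π : ℂ))) *
        (∫ τ : ℝ,
          LambdaR (c + τ * I) * mellin g (c + τ * I) * ((|y| : ℝ) : ℂ) ^ (-(c + τ * I)))
      = ((-Real.log |y| : ℝ) : ℂ) * g |y|
          + 𝓕 (fun x : ℝ => ((-Real.log |x| : ℝ) : ℂ) * 𝓕⁻ (fun t : ℝ => g |t|) x) y := by
  have hy' : 0 < |y| := abs_pos.2 hy
  have hyc : ((|y| : ℝ) : ℂ) ≠ 0 := by exact_mod_cast hy'.ne'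
  obtain ⟨S, hS⟩ := exists_schwartzMap_eq_comp_abs hgsm hgs hgsupp
  have he : Function.Even S := hS ▸ even_comp_abs g
  have heF : Function.Even (𝓕 (S : ℝ → ℂ)) := fourier_even he
  have hinv : 𝓕⁻ (fun t : ℝ => g |t|) = 𝓕 (S : ℝ → ℂ) := by
    ext x
    rw [← hS, Real.fourierInv_eq_fourier_neg, heF.eq]
  have hfi : Integrable (fun x : ℝ => (Real.log x : ℂ) * 𝓕 (S : ℝ → ℂ) x) :=
    (𝓕 S).integrable_log_mul heF
  have hV := verticalIntegrable_LambdaR_mul_mellin hgsm hgs hgsupp hc0 hc1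
  refine ⟨?_, ?_, ?_⟩
  · refine Integrable.mul_bdd (c := |y| ^ (-c)) hV ?_ (.of_forall fun τ => ?_)
    · refine Continuous.aestronglyMeasurable ?_
      exact Continuous.const_cpow (by fun_prop) (.inl hyc)
    · rw [norm_cpow_eq_rpow_re_of_pos hy']
      simp
  · simpa only [hinv, Real.log_abs] using hfi
  · set K : ℝ → ℂ := fun y : ℝ => -((Real.log y : ℂ) * S y) -
      𝓕 (fun x : ℝ => (Real.log x : ℂ) * 𝓕 (S : ℝ → ℂ) x) y with hK
    have hM : ∀ τ : ℝ, HasMellin K (c + τ * I)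
        (LambdaR (c + τ * I) * mellin g (c + τ * I)) := fun τ => by
      rw [← mellin_comp_abs, ← hS]
      exact S.hasMellin_fourier_log_mul_fourier he (by simpa) (by simpa)
    have hKc : ContinuousAt K |y| := by
      refine ContinuousAt.sub (ContinuousAt.neg (ContinuousAt.mul ?_ S.continuous.continuousAt))
        (continuous_fourier hfi).continuousAt
      exact continuous_ofReal.continuousAt.comp (Real.continuousAt_log hy'.ne')
    have hKV : VerticalIntegrable (mellin K) c := by
      simpa only [VerticalIntegrable, (hM _).2] using hV
    have := mellinInv_mellin_eq c K hy' (by simpa using (hM 0).1) hKV hKc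
    rw [mellinInv] at this
    simp only [(hM _).2, smul_eq_mul, real_smul] at this
    have e1 : 𝓕 (fun x : ℝ => ((-Real.log |x| : ℝ) : ℂ) * 𝓕⁻ (fun t : ℝ => g |t|) x) y =
        -𝓕 (fun x : ℝ => (Real.log x : ℂ) * 𝓕 (S : ℝ → ℂ) x) |y| := by
      have hev : 𝓕 (fun x : ℝ => (Real.log x : ℂ) * 𝓕 (S : ℝ → ℂ) x) |y| =
          𝓕 (fun x : ℝ => (Real.log x : ℂ) * 𝓕 (S : ℝ → ℂ) x) y := by
        rcases abs_choice y with h | h <;> rw [h]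
        exact fourier_even (even_log_mul heF) y
      rw [hev, hinv, Real.fourier_eq, Real.fourier_eq, ← integral_neg]
      simp [Real.log_abs]
    have e2 : (S : ℝ → ℂ) |y| = g |y| := by simp only [hS, abs_abs]
    rw [e1]
    simp only [hK, e2] at this
    push_cast at this ⊢
    rw [neg_mul, ← sub_eq_add_neg, ← this]
    congr 2
    ext τ
    ring
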